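/- arXiv:2510.04557 — 2 statements merged into one kernel-verified Lean document; each statement's English description precedes it below -/
import Mathlib

section
/- Let T be a tree with at least 3 vertices, with the set of leaves as boundary, and let r be the inscribed radius of T. If the diameter of T equals 2r+1, then λ₁(T) ≥ 4·sin²(π/(4r+6)) ≥ 1/(r+1)². -/
open scoped Classical
open Finset

/-- The Dirichlet energy `∑_{{x,y} ∈ E} (f(x) - f(y))²` of a function on the vertices,
computed as half of the sum over ordered adjacent pairs. -/
noncomputable def dirichletForm {V : Type*} [Fintype V] (G : SimpleGraph V) (f : V → ℝ) : ℝ :=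
  (∑ x : V, ∑ y : V, if G.Adj x y then (f x - f y) ^ 2 else 0) / 2

/-- The first Dirichlet eigenvalue of a graph `G` with boundary `B`:
the infimum of Rayleigh quotients of nonzero functions vanishing on `B`. -/
noncomputable def lambda1 {V : Type*} [Fintype V] (G : SimpleGraph V) (B : Finset V) : ℝ :=
  sInf { r : ℝ | ∃ f : V → ℝ, (∀ x ∈ B, f x = 0) ∧ f ≠ 0 ∧
    r = dirichletForm G f / ∑ x ∈ Bᶜ, f x ^ 2 }

/-- The distance from a vertex to a set of vertices. -/
noncomputable def distToSet {V : Type*} (G : SimpleGraph V) (B : Finset V) (v : V) : ℕ :=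
  sInf { n : ℕ | ∃ b ∈ B, G.dist v b = n }

/-- The inscribed radius of a graph with boundary: `max_{v ∈ V} dist(v, B)`. -/
noncomputable def inradius {V : Type*} [Fintype V] (G : SimpleGraph V) (B : Finset V) : ℕ :=
  Finset.univ.sup fun v => distToSet G B v

/-- The diameter of a graph: `max_{v,w ∈ V} dist(v, w)`. -/
noncomputable def graphDiam {V : Type*} [Fintype V] (G : SimpleGraph V) : ℕ :=
  Finset.univ.sup fun v => Finset.univ.sup fun w => G.dist v w

/-- The set of leaves (degree-one vertices) of a graph. -/
noncomputable def leaves {V : Type*} [Fintype V] (G : SimpleGraph V) : Finset V :=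
  Finset.univ.filter fun v => G.degree v = 1

/-- Barta's inequality: a positive function satisfying `Δg ≥ μ g` off the boundary bounds the
Dirichlet energy of functions vanishing on the boundary from below. -/
theorem mul_sum_sq_le_dirichletForm_of_supersolution {V : Type*} [Fintype V] (G : SimpleGraph V)
    (B : Finset V) (g : V → ℝ) (hg : ∀ x, 0 < g x) (μ : ℝ)
    (hsuper : ∀ x ∉ B, μ * g x ≤ ∑ y, if G.Adj x y then g x - g y else 0)
    (f : V → ℝ) (hf : ∀ x ∈ B, f x = 0) :
    μ * ∑ x ∈ Bᶜ, f x ^ 2 ≤ dirichletForm G f := by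
  have hpair (x y : V) : f x ^ 2 / g x * (g x - g y) + f y ^ 2 / g y * (g y - g x)
      ≤ (f x - f y) ^ 2 := by
    have hx := hg x
    have hy := hg y
    have h : (f x - f y) ^ 2 - (f x ^ 2 / g x * (g x - g y) + f y ^ 2 / g y * (g y - g x))
        = (f x * g y - f y * g x) ^ 2 / (g x * g y) := by
      field_simp
      ring
    have : 0 ≤ (f x * g y - f y * g x) ^ 2 / (g x * g y) := by positivity
    linarith
  have hpoint (x : V) : μ * f x ^ 2 ≤
      ∑ y, if G.Adj x y then f x ^ 2 / g x * (g x - g y) else 0 := by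
    by_cases hx : x ∈ B
    · simp [hf x hx]
    · have hgx := hg x
      calc μ * f x ^ 2 = f x ^ 2 / g x * (μ * g x) := by field_simp
        _ ≤ f x ^ 2 / g x * ∑ y, if G.Adj x y then g x - g y else 0 :=
          mul_le_mul_of_nonneg_left (hsuper x hx) (by positivity)
        _ = _ := by simp only [Finset.mul_sum, mul_ite, mul_zero]
  have hsum : ∑ x ∈ Bᶜ, f x ^ 2 = ∑ x, f x ^ 2 :=
    Finset.sum_subset (Finset.subset_univ _) fun x _ hx => by
      simp [hf x (by simpa using hx)]
  set S := ∑ x, ∑ y, if G.Adj x y then f x ^ 2 / g x * (g x - g y) else 0 with hS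
  have hS' : S = ∑ x, ∑ y, if G.Adj x y then f y ^ 2 / g y * (g y - g x) else 0 := by
    rw [hS, Finset.sum_comm]
    simp only [G.adj_comm]
  have hlow : μ * ∑ x, f x ^ 2 ≤ S := by
    rw [Finset.mul_sum]
    exact Finset.sum_le_sum fun x _ => hpoint x
  have hupp : S + S ≤ ∑ x, ∑ y, if G.Adj x y then (f x - f y) ^ 2 else 0 := by
    nth_rewrite 2 [hS']
    rw [hS, ← Finset.sum_add_distrib]
    refine Finset.sum_le_sum fun x _ => ?_
    rw [← Finset.sum_add_distrib]
    refine Finset.sum_le_sum fun y _ => ?_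
    split_ifs
    · exact hpair x y
    · simp
  rw [hsum, dirichletForm]
  linarith

theorem le_lambda1_of_supersolution {V : Type*} [Fintype V] (G : SimpleGraph V)
    (B : Finset V) (hB : ∃ x, x ∉ B) (g : V → ℝ) (hg : ∀ x, 0 < g x) (μ : ℝ)
    (hsuper : ∀ x ∉ B, μ * g x ≤ ∑ y, if G.Adj x y then g x - g y else 0) :
    μ ≤ lambda1 G B := by
  obtain ⟨x₀, hx₀⟩ := hB
  refine le_csInf ⟨_, Pi.single x₀ 1, fun x hx => ?_, ?_, rfl⟩ ?_
  · exact Pi.single_eq_of_ne (ne_of_mem_of_not_mem hx hx₀) _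
  · exact Pi.single_ne_zero_iff.mpr one_ne_zero
  · rintro _ ⟨f, hf, hf0, rfl⟩
    obtain ⟨x, hx⟩ := Function.ne_iff.mp hf0
    have hx' : f x ≠ 0 := hx
    have hxB : x ∈ Bᶜ := Finset.mem_compl.mpr fun h => hx' (hf x h)
    have hpos : 0 < ∑ x ∈ Bᶜ, f x ^ 2 :=
      Finset.sum_pos' (fun _ _ => sq_nonneg _) ⟨x, hxB, by positivity⟩
    rw [le_div_iff₀ hpos]
    exact mul_sum_sq_le_dirichletForm_of_supersolution G B g hg μ hsuper f hf

namespace SimpleGraph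

variable {V : Type*} {G : SimpleGraph V}

theorem Walk.dist_add_dist_of_mem_support (hG : G.Connected) {a b c : V} (p : G.Walk a b)
    (hp : p.length = G.dist a b) (hc : c ∈ p.support) :
    G.dist a b = G.dist a c + G.dist c b := by
  have h1 := congrArg Walk.length (p.take_spec hc)
  rw [Walk.length_append] at h1
  have h2 := dist_le (p.takeUntil c hc)
  have h3 := dist_le (p.dropUntil c hc)
  have h4 := hG.dist_triangle (u := a) (v := c) (w := b)
  omega

/-- In a tree, a vertex `c` between `a` and `b` is also between `a` and `x` or between `x`
and `b`, for every vertex `x`. -/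
theorem IsTree.dist_eq_or_dist_eq_of_dist_eq (hG : G.IsTree) {a b c : V}
    (h : G.dist a b = G.dist a c + G.dist c b) (x : V) :
    G.dist a x = G.dist a c + G.dist c x ∨ G.dist x b = G.dist x c + G.dist c b := by
  have hconn := hG.connected
  obtain ⟨p, hp⟩ := hconn.exists_walk_length_eq_dist a c
  obtain ⟨q, hq⟩ := hconn.exists_walk_length_eq_dist c b
  obtain ⟨s, hs⟩ := hconn.exists_walk_length_eq_dist a x
  obtain ⟨t, ht⟩ := hconn.exists_walk_length_eq_dist x b
  have hpq : (p.append q).IsPath :=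
    Walk.isPath_of_length_eq_dist _ (by rw [Walk.length_append]; omega)
  have heq := (hG.existsUnique_path a b).unique hpq (s.append t).bypass_isPath
  have hc : c ∈ (s.append t).support := by
    apply (s.append t).support_bypass_subset_support
    rw [← heq]
    simp [Walk.mem_support_append_iff]
  rcases (Walk.mem_support_append_iff _ _).mp hc with hc | hc
  · exact .inl (s.dist_add_dist_of_mem_support hconn hs hc)
  · exact .inr (t.dist_add_dist_of_mem_support hconn ht hc)

theorem IsTree.eq_of_adj_of_dist_add_one (hG : G.IsTree) {c x y z : V} (hy : G.Adj x y)
    (hz : G.Adj x z) (hyd : G.dist c y + 1 = G.dist c x) (hzd : G.dist c z + 1 = G.dist c x) :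
    y = z := by
  by_contra hne
  have hxy := dist_eq_one_iff_adj.mpr hy
  have hxz := dist_eq_one_iff_adj.mpr hz
  have hyx := dist_eq_one_iff_adj.mpr hy.symm
  have hpos := hG.connected.pos_dist_of_ne hne
  have hne1 : G.dist y z ≠ 1 := fun h =>
    hG.dist_ne_of_adj x (dist_eq_one_iff_adj.mp h) (hxy.trans hxz.symm)
  have htri := hG.connected.dist_triangle (u := y) (v := x) (w := z)
  rw [dist_comm (u := c) (v := x)] at hyd hzd
  rcases hG.dist_eq_or_dist_eq_of_dist_eq (a := y) (b := z) (c := x) (by omega) c with h | h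
  · rw [dist_comm (u := c) (v := y)] at hyd
    omega
  · rw [dist_comm (u := c) (v := x)] at h
    omega

/-- A tree of diameter at most `2 * k` has a vertex of eccentricity at most `k`. -/
theorem IsTree.exists_forall_dist_le (hG : G.IsTree) {k : ℕ} {a b : V}
    (hmax : ∀ x y, G.dist x y ≤ G.dist a b) (hk : G.dist a b ≤ 2 * k)
    (hk' : k ≤ G.dist a b) :
    ∃ c, ∀ x, G.dist c x ≤ k := by
  obtain ⟨p, hp⟩ := hG.connected.exists_walk_length_eq_dist a b
  have hc : p.getVert k ∈ p.support := p.getVert_mem_support k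
  have hadd := p.dist_add_dist_of_mem_support hG.connected hp hc
  have h1 : G.dist a (p.getVert k) ≤ k := (dist_le (p.take k)).trans (by simp)
  have h2 : G.dist (p.getVert k) b ≤ p.length - k := (dist_le (p.drop k)).trans (by simp)
  refine ⟨p.getVert k, fun x => ?_⟩
  have hax := hmax a x
  have hxb := hmax x b
  rcases hG.dist_eq_or_dist_eq_of_dist_eq hadd x with h | h
  · omega
  · rw [dist_comm (u := x) (v := p.getVert k)] at h
    omega

theorem IsTree.exists_degree_ne_one [Fintype V] [DecidableRel G.Adj] (hG : G.IsTree)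
    (hV : 3 ≤ Fintype.card V) : ∃ x, G.degree x ≠ 1 := by
  by_contra! h
  have h1 := G.sum_degrees_eq_twice_card_edges
  have h2 := hG.card_edgeFinset
  simp only [h, Finset.sum_const, Finset.card_univ, smul_eq_mul, mul_one] at h1
  omega

/-- On a tree, a cosine profile of the distance to a root is a supersolution at every vertex
with at least two neighbours, as long as it decreases away from the root. -/
theorem IsTree.cos_dist_supersolution [Fintype V] (hG : G.IsTree) (c : V)
    {θ : ℝ} (hθ : 0 ≤ θ) {x : V} (hx : ((G.dist c x : ℝ) + 1) * θ ≤ Real.pi)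
    (hdeg : 1 < G.degree x) :
    (2 - 2 * Real.cos θ) * Real.cos (G.dist c x * θ) ≤
      ∑ y, if G.Adj x y then Real.cos (G.dist c x * θ) - Real.cos (G.dist c y * θ) else 0 := by
  set d := G.dist c x with hd
  have hdθ : 0 ≤ (d : ℝ) * θ := by positivity
  have hSs : 0 ≤ Real.sin (d * θ) * Real.sin θ :=
    mul_nonneg (Real.sin_nonneg_of_nonneg_of_le_pi hdθ (by linarith))
      (Real.sin_nonneg_of_nonneg_of_le_pi hθ (by linarith))
  have hfar (y : V) (hy : G.dist c y = d + 1) : Real.cos (G.dist c y * θ) =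
      Real.cos (d * θ) * Real.cos θ - Real.sin (d * θ) * Real.sin θ := by
    rw [hy, ← Real.cos_add]
    push_cast
    ring_nf
  have hnear (y : V) (hy : d = G.dist c y + 1) : Real.cos (G.dist c y * θ) =
      Real.cos (d * θ) * Real.cos θ + Real.sin (d * θ) * Real.sin θ := by
    rw [← Real.cos_sub, hy]
    push_cast
    ring_nf
  have hmono (y : V) (hy : G.dist c y = d + 1) :
      Real.cos (G.dist c y * θ) ≤ Real.cos (d * θ) := by
    rw [hy]
    push_cast
    exact Real.cos_le_cos_of_nonneg_of_le_pi hdθ hx (by linarith)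
  obtain ⟨p, q, hp, hq, hpq, hother⟩ : ∃ p q, G.Adj x p ∧ G.Adj x q ∧ p ≠ q ∧
      ∀ y, G.Adj x y → y ≠ p → G.dist c y = d + 1 := by
    obtain ⟨y, hy, z, hz, hyz⟩ := Finset.one_lt_card.mp hdeg
    rw [mem_neighborFinset] at hy hz
    by_cases hex : ∃ p, G.Adj x p ∧ d = G.dist c p + 1
    · obtain ⟨p, hp, hpd⟩ := hex
      have hother (w : V) (hw : G.Adj x w) (hwp : w ≠ p) : G.dist c w = d + 1 :=
        (hG.dist_eq_dist_add_one_of_adj c hw).resolve_left fun h =>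
          hwp (hG.eq_of_adj_of_dist_add_one hw hp h.symm hpd.symm)
      by_cases hyp : y = p
      · exact ⟨p, z, hp, hz, hyp ▸ hyz, hother⟩
      · exact ⟨p, y, hp, hy, Ne.symm hyp, hother⟩
    · exact ⟨y, z, hy, hz, hyz, fun w hw _ =>
        (hG.dist_eq_dist_add_one_of_adj c hw).resolve_left fun h => hex ⟨w, hw, h⟩⟩
  have hqd := hfar q (hother q hq hpq.symm)
  have hpd : Real.cos (G.dist c p * θ) ≤
      Real.cos (d * θ) * Real.cos θ + Real.sin (d * θ) * Real.sin θ := by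
    rcases hG.dist_eq_dist_add_one_of_adj c hp with h | h
    · exact (hnear p h).le
    · rw [hfar p h]
      linarith
  rw [← Finset.sum_erase_add _ _ (Finset.mem_univ p), if_pos hp]
  have hq' : Real.cos (d * θ) - Real.cos (G.dist c q * θ) ≤ ∑ y ∈ Finset.univ.erase p,
      if G.Adj x y then Real.cos (d * θ) - Real.cos (G.dist c y * θ) else 0 := by
    have := Finset.single_le_sum
      (f := fun y => if G.Adj x y then Real.cos (d * θ) - Real.cos (G.dist c y * θ) else 0)
      (s := Finset.univ.erase p) (fun y hy => ?_)
      (Finset.mem_erase.mpr ⟨hpq.symm, Finset.mem_univ q⟩)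
    · simpa only [if_pos hq] using this
    · split_ifs with hxy
      · exact sub_nonneg.mpr (hmono y (hother y hxy (Finset.ne_of_mem_erase hy)))
      · exact le_rfl
  linarith

end SimpleGraph

theorem exists_dist_eq_graphDiam {V : Type*} [Fintype V] [Nonempty V] (G : SimpleGraph V) :
    ∃ a b, G.dist a b = graphDiam G := by
  obtain ⟨a, -, ha⟩ := Finset.exists_mem_eq_sup (Finset.univ : Finset V) Finset.univ_nonempty
    fun v => Finset.univ.sup fun w => G.dist v w
  obtain ⟨b, -, hb⟩ := Finset.exists_mem_eq_sup (Finset.univ : Finset V) Finset.univ_nonempty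
    fun w => G.dist a w
  exact ⟨a, b, (ha.trans hb).symm⟩

theorem dist_le_graphDiam {V : Type*} [Fintype V] (G : SimpleGraph V) (a b : V) :
    G.dist a b ≤ graphDiam G :=
  (Finset.le_sup (f := fun w => G.dist a w) (Finset.mem_univ b)).trans
    (Finset.le_sup (f := fun v => Finset.univ.sup fun w => G.dist v w) (Finset.mem_univ a))

theorem half_mul_le_sin_mul_pi_div_six {t : ℝ} (h0 : 0 ≤ t) (h1 : t ≤ 1) :
    t / 2 ≤ Real.sin (t * (Real.pi / 6)) := by
  have hpi := Real.pi_pos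
  have h := strictConcaveOn_sin_Icc.concaveOn.2 (x := Real.pi / 6) (y := 0)
    ⟨by positivity, by linarith⟩ ⟨le_rfl, hpi.le⟩ h0 (sub_nonneg.mpr h1) (by ring)
  simp only [Real.sin_pi_div_six, smul_eq_mul, Real.sin_zero, mul_zero, add_zero] at h
  linarith

theorem one_div_sq_le_four_mul_sin_sq (r : ℕ) :
    1 / ((r : ℝ) + 1) ^ 2 ≤ 4 * Real.sin (Real.pi / (4 * (r : ℝ) + 6)) ^ 2 := by
  have hr : (0 : ℝ) ≤ r := r.cast_nonneg
  have h := half_mul_le_sin_mul_pi_div_six (t := 3 / (2 * r + 3)) (by positivity)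
    ((div_le_one (by positivity)).mpr (by linarith))
  have harg : 3 / (2 * (r : ℝ) + 3) * (Real.pi / 6) = Real.pi / (4 * r + 6) := by
    field_simp
    ring
  rw [harg] at h
  have hle : 1 / (2 * ((r : ℝ) + 1)) ≤ 3 / (2 * r + 3) / 2 := by
    rw [div_div, div_le_div_iff₀ (by positivity) (by positivity)]
    nlinarith
  calc 1 / ((r : ℝ) + 1) ^ 2 = 4 * (1 / (2 * ((r : ℝ) + 1))) ^ 2 := by
        field_simp
        ring
    _ ≤ _ := by
        gcongr
        exact hle.trans h

theorem stmt3 {V : Type*} [Fintype V] (T : SimpleGraph V) (hT : T.IsTree)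
    (hV : 3 ≤ Fintype.card V) (r : ℕ) (hr : r = inradius T (leaves T))
    (hdiam : graphDiam T = 2 * r + 1) :
    4 * Real.sin (Real.pi / (4 * (r : ℝ) + 6)) ^ 2 ≤ lambda1 T (leaves T) ∧
    1 / ((r : ℝ) + 1) ^ 2 ≤ 4 * Real.sin (Real.pi / (4 * (r : ℝ) + 6)) ^ 2 := by
  refine ⟨?_, one_div_sq_le_four_mul_sin_sq r⟩
  have : Nontrivial V := Fintype.one_lt_card_iff_nontrivial.mp (by omega)
  obtain ⟨a, b, hab⟩ := exists_dist_eq_graphDiam T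
  obtain ⟨c, hc⟩ := hT.exists_forall_dist_le (k := r + 1)
    (fun x y => hab ▸ dist_le_graphDiam T x y) (by omega) (by omega)
  have hpi := Real.pi_pos
  have hr0 : (0 : ℝ) ≤ r := r.cast_nonneg
  set θ : ℝ := Real.pi / (2 * r + 3) with hθ
  have hθ0 : 0 < θ := by positivity
  have hθr : (2 * r + 3) * θ = Real.pi := by
    rw [hθ]
    field_simp
  have hcr (x : V) : (T.dist c x : ℝ) * θ ≤ (r + 1) * θ :=
    mul_le_mul_of_nonneg_right (by exact_mod_cast hc x) hθ0.le
  have hμ : 4 * Real.sin (Real.pi / (4 * (r : ℝ) + 6)) ^ 2 = 2 - 2 * Real.cos θ := by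
    have harg : θ = 2 * (Real.pi / (4 * (r : ℝ) + 6)) := by
      rw [hθ]
      field_simp
      ring
    rw [harg, Real.cos_two_mul, Real.sin_sq]
    ring
  have hrθ : 0 ≤ (r : ℝ) * θ := by positivity
  rw [hμ]
  refine le_lambda1_of_supersolution T _ ?_ (fun x => Real.cos (T.dist c x * θ)) ?_ _ ?_
  · obtain ⟨x, hx⟩ := hT.exists_degree_ne_one hV
    exact ⟨x, by simpa [leaves] using hx⟩
  · intro x
    refine Real.cos_pos_of_mem_Ioo ⟨?_, ?_⟩
    · have : 0 ≤ (T.dist c x : ℝ) * θ := by positivity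
      linarith
    · linarith [hcr x]
  · intro x hx
    refine hT.cos_dist_supersolution c hθ0.le (by linarith [hcr x]) ?_
    have hpos := hT.connected.preconnected.degree_pos_of_nontrivial x
    have hne : T.degree x ≠ 1 := by simpa [leaves] using hx
    omega
end

section
/- Let T be a tree with at least 3 vertices, with the set B of leaves as boundary and interior Ω the set of non-leaf vertices. Then λ₁(T) ≤ |B|/|Ω|, with equality if and only if |Ω| divides |B| and every interior vertex is adjacent to exactly |B|/|Ω| leaves. -/
open scoped Classical
open Finset

section DirichletForm

variable {V : Type*} [Fintype V] {G : SimpleGraph V} {B : Finset V}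

theorem dirichletForm_nonneg (G : SimpleGraph V) (f : V → ℝ) : 0 ≤ dirichletForm G f := by
  unfold dirichletForm
  refine div_nonneg (sum_nonneg fun x _ => sum_nonneg fun y _ => ?_) zero_le_two
  split_ifs <;> positivity

/-- The energy carried by the pairs of adjacent interior vertices. -/
noncomputable def interiorEnergy (G : SimpleGraph V) (B : Finset V) (f : V → ℝ) : ℝ :=
  (∑ x ∈ Bᶜ, ∑ y ∈ Bᶜ, if G.Adj x y then (f x - f y) ^ 2 else 0) / 2

theorem interiorEnergy_nonneg (G : SimpleGraph V) (B : Finset V) (f : V → ℝ) :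
    0 ≤ interiorEnergy G B f := by
  unfold interiorEnergy
  refine div_nonneg (sum_nonneg fun x _ => sum_nonneg fun y _ => ?_) zero_le_two
  split_ifs <;> positivity

/-- If the boundary is an independent set, the energy of a function vanishing on it splits into
an interior part and a potential counting boundary neighbours. -/
theorem dirichletForm_eq_interiorEnergy_add (hB : ∀ x ∈ B, ∀ y ∈ B, ¬ G.Adj x y) {f : V → ℝ}
    (hf : ∀ x ∈ B, f x = 0) :
    dirichletForm G f =
      interiorEnergy G B f + ∑ x ∈ Bᶜ, (#{y ∈ B | G.Adj x y} : ℝ) * f x ^ 2 := by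
  have hmix : ∀ x, (∑ y ∈ B, if G.Adj x y then (f x - f y) ^ 2 else 0) =
      (#{y ∈ B | G.Adj x y} : ℝ) * f x ^ 2 := fun x => by
    rw [← sum_filter, sum_congr rfl (g := fun _ => f x ^ 2), sum_const, nsmul_eq_mul]
    intro y hy
    rw [hf y (mem_filter.1 hy).1, sub_zero]
  have hbb : (∑ x ∈ B, ∑ y ∈ B, if G.Adj x y then (f x - f y) ^ 2 else 0) = 0 :=
    sum_eq_zero fun x hx => sum_eq_zero fun y hy => if_neg (hB x hx y hy)
  have hbi : (∑ x ∈ B, ∑ y ∈ Bᶜ, if G.Adj x y then (f x - f y) ^ 2 else 0) =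
      ∑ x ∈ Bᶜ, (#{y ∈ B | G.Adj x y} : ℝ) * f x ^ 2 := by
    rw [sum_comm]
    refine sum_congr rfl fun x _ => ?_
    rw [← hmix x]
    refine sum_congr rfl fun y _ => ?_
    rw [G.adj_comm, sub_sq_comm]
  unfold dirichletForm interiorEnergy
  rw [← sum_add_sum_compl B]
  simp_rw [← sum_add_sum_compl B (fun y => if G.Adj _ y then (f _ - f y) ^ 2 else 0)]
  rw [sum_add_distrib, sum_add_distrib, hbb, hbi, sum_congr rfl fun x _ => hmix x]
  ring

theorem sum_sq_compl_pos {f : V → ℝ} (hf : ∀ x ∈ B, f x = 0) (hf0 : f ≠ 0) :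
    0 < ∑ x ∈ Bᶜ, f x ^ 2 := by
  obtain ⟨x, hx⟩ := Function.ne_iff.1 hf0
  have hxB : x ∈ Bᶜ := mem_compl.2 fun h => hx (hf x h)
  exact sum_pos' (fun _ _ => sq_nonneg _) ⟨x, hxB, sq_pos_of_ne_zero hx⟩

theorem lambda1_mul_le_dirichletForm (G : SimpleGraph V) {f : V → ℝ} (hf : ∀ x ∈ B, f x = 0) :
    lambda1 G B * ∑ x ∈ Bᶜ, f x ^ 2 ≤ dirichletForm G f := by
  rcases eq_or_ne f 0 with rfl | hf0
  · simpa using dirichletForm_nonneg G 0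
  · rw [← le_div_iff₀ (sum_sq_compl_pos hf hf0)]
    refine csInf_le ⟨0, ?_⟩ ⟨f, hf, hf0, rfl⟩
    rintro _ ⟨g, -, -, rfl⟩
    exact div_nonneg (dirichletForm_nonneg G g) (sum_nonneg fun _ _ => sq_nonneg _)

theorem le_lambda1 (hne : Bᶜ.Nonempty) {c : ℝ}
    (h : ∀ f : V → ℝ, (∀ x ∈ B, f x = 0) → c * ∑ x ∈ Bᶜ, f x ^ 2 ≤ dirichletForm G f) :
    c ≤ lambda1 G B := by
  obtain ⟨v, hv⟩ := hne
  refine le_csInf ⟨_, fun x => if x ∈ B then 0 else 1, fun x hx => if_pos hx, ?_, rfl⟩ ?_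
  · exact Function.ne_iff.2 ⟨v, by simp [mem_compl.1 hv]⟩
  · rintro _ ⟨f, hf, hf0, rfl⟩
    exact (le_div_iff₀ (sum_sq_compl_pos hf hf0)).2 (h f hf)

/-- The Rayleigh inequality for the indicator of the interior. -/
theorem lambda1_mul_card_le (hB : ∀ x ∈ B, ∀ y ∈ B, ¬ G.Adj x y) :
    lambda1 G B * (#Bᶜ : ℝ) ≤ ∑ x ∈ Bᶜ, (#{y ∈ B | G.Adj x y} : ℝ) := by
  set f : V → ℝ := fun x => if x ∈ B then 0 else 1
  have hf : ∀ x ∈ B, f x = 0 := fun x hx => if_pos hx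
  have hf1 : ∀ x ∈ Bᶜ, f x = 1 := fun x hx => if_neg (mem_compl.1 hx)
  have hI : interiorEnergy G B f = 0 := by
    unfold interiorEnergy
    rw [sum_eq_zero fun x hx => sum_eq_zero fun y hy => ?_, zero_div]
    simp [hf1 x hx, hf1 y hy]
  have hsum : ∀ w : V → ℝ, ∑ x ∈ Bᶜ, w x * f x ^ 2 = ∑ x ∈ Bᶜ, w x := fun w =>
    sum_congr rfl fun x hx => by rw [hf1 x hx, one_pow, mul_one]
  have h := lambda1_mul_le_dirichletForm G hf
  have hone := hsum fun _ => 1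
  simp only [one_mul, sum_const, nsmul_eq_mul, mul_one] at hone
  rwa [dirichletForm_eq_interiorEnergy_add hB hf, hI, zero_add,
    hsum fun x => (#{y ∈ B | G.Adj x y} : ℝ), hone] at h

/-- If the indicator of the interior attains `lambda1`, then every interior vertex has exactly
`lambda1` boundary neighbours. -/
theorem card_boundary_neighbors_eq_lambda1 (hB : ∀ x ∈ B, ∀ y ∈ B, ¬ G.Adj x y)
    (heq : lambda1 G B * (#Bᶜ : ℝ) = ∑ x ∈ Bᶜ, (#{y ∈ B | G.Adj x y} : ℝ)) {v : V}
    (hv : v ∈ Bᶜ) : (#{y ∈ B | G.Adj v y} : ℝ) = lambda1 G B := by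
  set c := interiorEnergy G B (Pi.single v 1)
  set e := (#{y ∈ B | G.Adj v y} : ℝ) - lambda1 G B with he
  have key : ∀ t : ℝ, 0 ≤ (c + e) * (t * t) + 2 * e * t + 0 := fun t => by
    set f : V → ℝ := fun x => if x ∈ B then 0 else 1 + t * (Pi.single v 1 : V → ℝ) x
    have hf : ∀ x ∈ B, f x = 0 := fun x hx => if_pos hx
    have hf1 : ∀ x ∈ Bᶜ, f x = 1 + t * (Pi.single v 1 : V → ℝ) x :=
      fun x hx => if_neg (mem_compl.1 hx)
    have hI : interiorEnergy G B f = t ^ 2 * c := by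
      simp only [c, interiorEnergy]
      rw [← mul_div_assoc, mul_sum]
      congr 1
      refine sum_congr rfl fun x hx => ?_
      rw [mul_sum]
      refine sum_congr rfl fun y hy => ?_
      rw [hf1 x hx, hf1 y hy]
      split_ifs <;> ring
    have hsum : ∀ w : V → ℝ,
        ∑ x ∈ Bᶜ, w x * f x ^ 2 = ∑ x ∈ Bᶜ, w x + (2 * t + t ^ 2) * w v := fun w => by
      have : ∀ x ∈ Bᶜ, w x * f x ^ 2 = w x + if v = x then (2 * t + t ^ 2) * w x else 0 := by
        intro x hx
        rw [hf1 x hx]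
        split_ifs with hvx
        · subst hvx
          rw [Pi.single_eq_same]
          ring
        · rw [Pi.single_eq_of_ne (Ne.symm hvx)]
          ring
      rw [sum_congr rfl this, sum_add_distrib, sum_ite_eq, if_pos hv]
    have h := lambda1_mul_le_dirichletForm G hf
    have hone := hsum fun _ => 1
    simp only [one_mul, sum_const, nsmul_eq_mul, mul_one] at hone
    rw [dirichletForm_eq_interiorEnergy_add hB hf, hI, hsum fun x => (#{y ∈ B | G.Adj x y} : ℝ),
      hone, ← heq] at h
    rw [he]
    linarith
  have hd := discrim_le_zero key
  rw [discrim] at hd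
  have : e = 0 := by nlinarith [sq_nonneg e]
  linarith

end DirichletForm

section Leaves

variable {V : Type*} [Fintype V] {G : SimpleGraph V}

theorem mem_leaves {x : V} : x ∈ leaves G ↔ ∃! y, G.Adj x y := by
  rw [leaves, mem_filter, ← G.degree_eq_one_iff_existsUnique_adj]
  simp

theorem SimpleGraph.Connected.not_adj_of_mem_leaves (hG : G.Connected)
    (hV : 3 ≤ Fintype.card V) : ∀ x ∈ leaves G, ∀ y ∈ leaves G, ¬ G.Adj x y := by
  intro x hx y hy hxy
  have hclosed : ∀ u w, G.Adj u w → u ∈ ({x, y} : Finset V) → w ∈ ({x, y} : Finset V) := by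
    intro u w huw hu
    rw [mem_insert, mem_singleton] at hu ⊢
    rcases hu with rfl | rfl
    · exact Or.inr ((mem_leaves.1 hx).unique huw hxy)
    · exact Or.inl ((mem_leaves.1 hy).unique huw hxy.symm)
  have hwalk : ∀ u w, G.Walk u w → u ∈ ({x, y} : Finset V) → w ∈ ({x, y} : Finset V) := by
    intro u w p
    induction p with
    | nil => exact id
    | cons h _ ih => exact fun hu => ih (hclosed _ _ h hu)
  have huniv : (univ : Finset V) ⊆ {x, y} := fun w _ =>
    (hG.preconnected x w).elim fun p => hwalk x w p (mem_insert_self _ _)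
  have := (card_le_card huniv).trans card_le_two
  rw [card_univ] at this
  omega

theorem SimpleGraph.Connected.compl_leaves_nonempty (hG : G.Connected)
    (hV : 3 ≤ Fintype.card V) : (leaves G)ᶜ.Nonempty := by
  obtain ⟨x⟩ := hG.nonempty
  by_cases hx : x ∈ leaves G
  · obtain ⟨y, hy, -⟩ := mem_leaves.1 hx
    exact ⟨y, mem_compl.2 fun h => hG.not_adj_of_mem_leaves hV x hx y h hy⟩
  · exact ⟨x, mem_compl.2 hx⟩

theorem SimpleGraph.Connected.sum_card_adj_leaves (hG : G.Connected)
    (hV : 3 ≤ Fintype.card V) :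
    ∑ x ∈ (leaves G)ᶜ, #{y ∈ leaves G | G.Adj x y} = #(leaves G) := by
  have h := sum_card_bipartiteAbove_eq_sum_card_bipartiteBelow
    (s := (leaves G)ᶜ) (t := leaves G) G.Adj
  simp only [bipartiteAbove, bipartiteBelow] at h
  rw [h, card_eq_sum_ones]
  refine sum_congr rfl fun b hb => ?_
  obtain ⟨y, hy, huniq⟩ := mem_leaves.1 hb
  refine card_eq_one.2 ⟨y, ?_⟩
  ext z
  simp only [mem_filter, mem_compl, mem_singleton]
  refine ⟨fun hz => huniq z hz.2.symm, ?_⟩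
  rintro rfl
  exact ⟨fun h => hG.not_adj_of_mem_leaves hV b hb z h hy, hy.symm⟩

end Leaves

theorem stmt5 {V : Type*} [Fintype V] (T : SimpleGraph V) (hT : T.IsTree)
    (hV : 3 ≤ Fintype.card V) :
    lambda1 T (leaves T) ≤ ((leaves T).card : ℝ) / (((leaves T)ᶜ : Finset V).card : ℝ) ∧
    (lambda1 T (leaves T) = ((leaves T).card : ℝ) / (((leaves T)ᶜ : Finset V).card : ℝ) ↔
      ((leaves T)ᶜ : Finset V).card ∣ (leaves T).card ∧
      ∀ x ∈ ((leaves T)ᶜ : Finset V),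
        ((leaves T).filter fun y => T.Adj x y).card =
          (leaves T).card / ((leaves T)ᶜ : Finset V).card) := by
  have hB := hT.connected.not_adj_of_mem_leaves hV
  have hne := hT.connected.compl_leaves_nonempty hV
  have hpos : 0 < #(leaves T)ᶜ := card_pos.2 hne
  have hposR : (0 : ℝ) < #(leaves T)ᶜ := Nat.cast_pos.2 hpos
  have hsum := hT.connected.sum_card_adj_leaves hV
  have hsumR : ∑ x ∈ (leaves T)ᶜ, (#{y ∈ leaves T | T.Adj x y} : ℝ) = #(leaves T) := by
    exact_mod_cast hsum
  have hle : lambda1 T (leaves T) ≤ (#(leaves T) : ℝ) / #(leaves T)ᶜ := by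
    rw [le_div_iff₀ hposR, ← hsumR]
    exact lambda1_mul_card_le hB
  refine ⟨hle, fun heq => ?_, ?_⟩
  · have hv : ∀ x ∈ (leaves T)ᶜ,
        #(leaves T) = #(leaves T)ᶜ * #{y ∈ leaves T | T.Adj x y} := by
      intro x hx
      rw [eq_div_iff hposR.ne', ← hsumR] at heq
      have h := card_boundary_neighbors_eq_lambda1 hB heq hx
      rw [← h, hsumR] at heq
      rw [mul_comm]
      exact_mod_cast heq.symm
    obtain ⟨v, hvm⟩ := hne
    exact ⟨⟨_, hv v hvm⟩, fun x hx => (Nat.div_eq_of_eq_mul_right hpos (hv x hx)).symm⟩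
  · rintro ⟨hdvd, hdeg⟩
    refine le_antisymm hle (le_lambda1 hne fun f hf => ?_)
    rw [dirichletForm_eq_interiorEnergy_add hB hf, mul_sum]
    refine le_add_of_nonneg_of_le (interiorEnergy_nonneg T _ f) (sum_le_sum fun x hx => ?_)
    rw [hdeg x hx, Nat.cast_div hdvd hposR.ne']
end
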